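/- Let θ and θ' be extended configurations with θ' ⪯ θ, and let D ⊆ 𝔻 be a finite set of data values. Then there exist an extended configuration θ̃ and a function f : 𝔻 → 𝔻 such that: (1) θ' reaches θ̃ by n applications of →inc for some n ≤ |D|; (2) θ̃ ⪯_f θ; and (3) f is injective on D. -/

import Mathlib

namespace ECBUDA

/-- Evaluation of a nonempty word under the semigroup homomorphism determined
by the letter map `h` (and `none` on the empty word). -/
def hword {A B S : Type} [Mul S] (h : A × B → S) : List (A × B) → Option S
  | [] => none
  | c :: w => some (w.foldl (fun s x => s * h x) (h c))

/-- (NF1): the homomorphism takes distinct values on words of length one: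
`h(w) = h(c)` iff `w = c`. -/
def NF1 {A B S : Type} [Mul S] (h : A × B → S) : Prop :=
  ∀ (w : List (A × B)) (c : A × B), hword h w = some (h c) ↔ w = [c]

/-- Basic tests allowed in normal form (NF2): state tests, `⟨μ⟩^=`, `⟨μ⟩^≠`
and `root`. -/
inductive NTest (Q S : Type) : Type where
  | state : Q → NTest Q S
  | deq : S → NTest Q S
  | dneq : S → NTest Q S
  | root : NTest Q S

/-- Basic actions. -/
inductive NAct (Q : Type) : Type where
  | accept : NAct Q
  | keep : Q → NAct Q
  | store : Q → NAct Q
  | guess : Q → NAct Q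
  | univ : Q → NAct Q

/-- The set `TA`: possibly negated basic tests (the Boolean flag `true` marks
negation), basic actions, and the three symbols `⊤`, `⊤g`, `⊥`. -/
inductive TA (Q S : Type) : Type where
  | test : Bool → NTest Q S → TA Q S
  | act : NAct Q → TA Q S
  | top : TA Q S
  | topg : TA Q S
  | bot : TA Q S

/-- A transition of the automaton in normal form: a conjunction of possibly
negated basic tests with a conjunction of basic actions. -/
abbrev NTrans (Q S : Type) : Type := List (Bool × NTest Q S) × List (NAct Q)

/-- An extended configuration `(Δ, Γ, r, m)`: `Δ` a finite set of threads,
`Γ` a finite set of pairs (semigroup element, data value) containing exactly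
one pair whose first component is the image under `h` of a letter (this letter
is the label of the configuration and the associated data value its data
value), and Booleans `r` (root) and `m` (merge). -/
structure EConf (A B Q S : Type) (D : Type) (h : A × B → S) : Type where
  Δ : Set (Q × TA Q S × D)
  Γ : Set (S × D)
  r : Bool
  m : Bool
  finΔ : Δ.Finite
  finΓ : Γ.Finite
  uniq : ∃! x : S × D, x ∈ Γ ∧ ∃ c : A × B, x.1 = h c

variable {A B Q S D : Type} {h : A × B → S}

/-- `Δ(d)`: the threads carrying the data value `d`. -/
def EConf.dfun (θ : EConf A B Q S D h) (d : D) : Set (Q × TA Q S) :=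
  {qa | (qa.1, qa.2, d) ∈ θ.Δ}

/-- `Γ(d)`: the semigroup elements of downward paths leading to `d`. -/
def EConf.gfun (θ : EConf A B Q S D h) (d : D) : Set S :=
  {μ | (μ, d) ∈ θ.Γ}

/-- The data values occurring in the extended configuration. -/
def EConf.dataset (θ : EConf A B Q S D h) : Set D :=
  {d | (∃ qa : Q × TA Q S, (qa.1, qa.2, d) ∈ θ.Δ) ∨ ∃ μ : S, (μ, d) ∈ θ.Γ}

/-- The unique pair of `Γ` recording the label and the data value of the root. -/
def EConf.rootInfo (θ : EConf A B Q S D h) : Set (S × D) :=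
  {x ∈ θ.Γ | ∃ c : A × B, x.1 = h c}

/-- The set of data values of the root pair (a singleton). -/
def EConf.rootData (θ : EConf A B Q S D h) : Set D :=
  {d | ∃ μ : S, (μ, d) ∈ θ.Γ ∧ ∃ c : A × B, μ = h c}

/-- The profile `(A₀, A₁, r, m)` of an extended configuration: `Aᵢ` is the set
of those `χ ⊆ S` such that exactly `i` data values `d` satisfy `Γ(d) = χ`. -/
def EConf.profile (θ : EConf A B Q S D h) :
    Set (Set S) × Set (Set S) × Bool × Bool :=
  ({χ | {d | θ.gfun d = χ}.encard = 0},
   {χ | {d | θ.gfun d = χ}.encard = 1}, θ.r, θ.m)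

/-- `θ₁ ⪯_f θ₂`. -/
def pleF (f : D → D) (θ₁ θ₂ : EConf A B Q S D h) : Prop :=
  θ₁.profile = θ₂.profile ∧ θ₁.dataset ⊆ Set.range f ∧
  ∀ d : D, θ₁.dfun (f d) ⊆ θ₂.dfun d ∧ θ₁.gfun (f d) = θ₂.gfun d

/-- The well-quasi-order `⪯` on extended configurations. -/
def ple (θ₁ θ₂ : EConf A B Q S D h) : Prop :=
  ∃ f : D → D, pleF f θ₁ θ₂

/-- `θ₁ ∼ θ₂`: equal up to a bijection of the data values. -/
def simEquiv (θ₁ θ₂ : EConf A B Q S D h) : Prop :=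
  ∃ g : D ≃ D,
    θ₂.Δ = {x | (x.1, x.2.1, g.symm x.2.2) ∈ θ₁.Δ} ∧
    θ₂.Γ = {x | (x.1, g.symm x.2) ∈ θ₁.Γ} ∧
    θ₂.r = θ₁.r ∧ θ₂.m = θ₁.m

/-- The closure of a set of extended configurations under `∼`. -/
def simClose (Θ : Set (EConf A B Q S D h)) : Set (EConf A B Q S D h) :=
  {θ | ∃ θ' ∈ Θ, simEquiv θ θ'}

/-- `Θ ≤min Θ'`: every member of `Θ'` is minorized by a member of `Θ`. -/
def leMin (Θ Θ' : Set (EConf A B Q S D h)) : Prop :=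
  ∀ θ' ∈ Θ', ∃ θ ∈ Θ, ple θ θ'

/-- Satisfaction of a basic test by the thread `(q, d)` in an extended
configuration. -/
def ntestHolds (θ : EConf A B Q S D h) (q : Q) (d : D) : NTest Q S → Prop
  | .state p => q = p
  | .deq μ => (μ, d) ∈ θ.Γ
  | .dneq μ => ∃ e : D, e ≠ d ∧ (μ, e) ∈ θ.Γ
  | .root => θ.r = true

def taTestHolds (θ : EConf A B Q S D h) (q : Q) (d : D) (neg : Bool)
    (t : NTest Q S) : Prop :=
  if neg then ¬ ntestHolds θ q d t else ntestHolds θ q d t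

/-- The tests and actions occurring in a transition, as elements of `TA`. -/
def taSet (tr : NTrans Q S) : Set (TA Q S) :=
  {x | (∃ nt ∈ tr.1, x = TA.test nt.1 nt.2) ∨ ∃ a ∈ tr.2, x = TA.act a}

/-- The ε-transitions of the transition system: they keep `Γ`, `r` (hence the
label and data value), require the merge flag to be false, and rewrite one
thread of `Δ`. -/
def epsStep (δ : List (NTrans Q S)) (θ₁ θ₂ : EConf A B Q S D h) : Prop :=
  θ₁.m = false ∧ θ₂.m = false ∧ θ₂.r = θ₁.r ∧ θ₂.Γ = θ₁.Γ ∧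
  ∃ (q : Q) (d : D),
    -- applying a transition of δ to a ⊥-thread
    ((∃ tr ∈ δ, (q, TA.bot, d) ∈ θ₁.Δ ∧
        θ₂.Δ = (θ₁.Δ \ {(q, TA.bot, d)}) ∪
          {x | x.1 = q ∧ x.2.2 = d ∧ x.2.1 ∈ taSet tr}) ∨
    -- univ
    (∃ p : Q, (q, TA.act (NAct.univ p), d) ∈ θ₁.Δ ∧
        θ₂.Δ = (θ₁.Δ \ {(q, TA.act (NAct.univ p), d)}) ∪
          {x | x.1 = p ∧ x.2.1 = TA.top ∧ ∃ μ : S, (μ, x.2.2) ∈ θ₁.Γ}) ∨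
    -- guess
    (∃ (p : Q) (d' : D), (q, TA.act (NAct.guess p), d) ∈ θ₁.Δ ∧
        θ₂.Δ = (θ₁.Δ \ {(q, TA.act (NAct.guess p), d)}) ∪ {(p, TA.topg, d')}) ∨
    -- store
    (∃ (p : Q) (d' : D), (q, TA.act (NAct.store p), d) ∈ θ₁.Δ ∧
        d' ∈ θ₁.rootData ∧
        θ₂.Δ = (θ₁.Δ \ {(q, TA.act (NAct.store p), d)}) ∪ {(p, TA.top, d')}) ∨
    -- keep
    (∃ p : Q, (q, TA.act (NAct.keep p), d) ∈ θ₁.Δ ∧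
        θ₂.Δ = (θ₁.Δ \ {(q, TA.act (NAct.keep p), d)}) ∪ {(p, TA.top, d)}) ∨
    -- accept
    ((q, TA.act NAct.accept, d) ∈ θ₁.Δ ∧
        θ₂.Δ = θ₁.Δ \ {(q, TA.act NAct.accept, d)}) ∨
    -- a (possibly negated) basic test, deleted if it holds
    (∃ (neg : Bool) (t : NTest Q S), (q, TA.test neg t, d) ∈ θ₁.Δ ∧
        taTestHolds θ₁ q d neg t ∧
        θ₂.Δ = θ₁.Δ \ {(q, TA.test neg t, d)}))

/-- The transition `→inc(S, χ)`. -/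
def incStep (Sq : Set (Q × TA Q S)) (χ : Set S) (θ₁ θ₂ : EConf A B Q S D h) :
    Prop :=
  (∃ d : D, θ₁.dfun d = Sq ∧ θ₁.gfun d = χ) ∧
  (∃ e₁ e₂ : D, e₁ ≠ e₂ ∧ θ₁.gfun e₁ = χ ∧ θ₁.gfun e₂ = χ) ∧
  ∃ e : D, e ∉ θ₁.dataset ∧ θ₂.r = θ₁.r ∧ θ₂.m = θ₁.m ∧
    (∀ d : D, d ≠ e → θ₂.dfun d = θ₁.dfun d ∧ θ₂.gfun d = θ₁.gfun d) ∧
    θ₂.dfun e = {qa ∈ Sq | qa.2 ≠ TA.topg} ∧ θ₂.gfun e = χ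

/-- The transition `→inc`. -/
def inc (θ₁ θ₂ : EConf A B Q S D h) : Prop :=
  ∃ (Sq : Set (Q × TA Q S)) (χ : Set S), incStep Sq χ θ₁ θ₂

/-- The transition `→grow`, adding a new root on top. -/
def growStep [Semigroup S] (θ₁ θ₂ : EConf A B Q S D h) : Prop :=
  θ₁.r = false ∧ θ₁.m = false ∧
  (∀ x ∈ θ₁.Δ, x.2.1 = TA.top ∨ x.2.1 = TA.topg) ∧
  θ₂.Δ = {x | x.2.1 = TA.bot ∧ ∃ α : TA Q S, (x.1, α, x.2.2) ∈ θ₁.Δ} ∧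
  ∃ (c : A × B) (d' : D),
    θ₂.Γ = {y | ∃ μ : S, ∃ e : D, (μ, e) ∈ θ₁.Γ ∧ y = (h c * μ, e)} ∪ {(h c, d')}

/-- The transition `→merge`, merging two extended configurations with the same
label and data value. -/
def mergeStep (θ₁ θ₂ θ₀ : EConf A B Q S D h) : Prop :=
  θ₁.rootInfo = θ₂.rootInfo ∧ θ₀.rootInfo = θ₁.rootInfo ∧
  θ₁.m = true ∧ θ₂.m = true ∧ θ₀.r = θ₁.r ∧ θ₁.r = θ₂.r ∧
  θ₀.Δ = θ₁.Δ ∪ θ₂.Δ ∧ θ₀.Γ = θ₁.Γ ∪ θ₂.Γ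

/-- Any single (ε-, inc- or grow-) transition step of the transition system. -/
def anyStep [Semigroup S] (δ : List (NTrans Q S)) (θ₁ θ₂ : EConf A B Q S D h) :
    Prop :=
  epsStep δ θ₁ θ₂ ∨ inc θ₁ θ₂ ∨ growStep θ₁ θ₂

/-- `Θ ⟹ θ`: one derivation step from a set of extended configurations. -/
def stepFrom [Semigroup S] (δ : List (NTrans Q S))
    (Θ : Set (EConf A B Q S D h)) (θ : EConf A B Q S D h) : Prop :=
  (∃ θ₁ ∈ Θ, anyStep δ θ₁ θ) ∨ ∃ θ₁ ∈ Θ, ∃ θ₂ ∈ Θ, mergeStep θ₁ θ₂ θ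

/-- `Θ ⟹⁺ θ`. -/
inductive Derives [Semigroup S] (δ : List (NTrans Q S)) :
    Set (EConf A B Q S D h) → EConf A B Q S D h → Prop where
  | base {Θ : Set (EConf A B Q S D h)} {θ : EConf A B Q S D h} :
      stepFrom δ Θ θ → Derives δ Θ θ
  | step {Θ : Set (EConf A B Q S D h)} {θ' θ : EConf A B Q S D h} :
      stepFrom δ Θ θ' → Derives δ (Θ ∪ {θ'}) θ → Derives δ Θ θ

/-- `Θ ⟹ⁿ θ`: derivation in at most `n` steps. -/
inductive DerivesN [Semigroup S] (δ : List (NTrans Q S)) :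
    ℕ → Set (EConf A B Q S D h) → EConf A B Q S D h → Prop where
  | base {n : ℕ} {Θ : Set (EConf A B Q S D h)} {θ : EConf A B Q S D h} :
      stepFrom δ Θ θ → DerivesN δ (n + 1) Θ θ
  | step {n : ℕ} {Θ : Set (EConf A B Q S D h)} {θ' θ : EConf A B Q S D h} :
      stepFrom δ Θ θ' → DerivesN δ n (Θ ∪ {θ'}) θ → DerivesN δ (n + 1) Θ θ

/-- `n`-fold composition of a binary relation. -/
def relPow {α : Type} (R : α → α → Prop) : ℕ → α → α → Prop
  | 0 => Eq
  | n + 1 => fun a c => ∃ b, R a b ∧ relPow R n b c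

/-- An initial extended configuration (abstracting a leaf). -/
def Initial (q0 : Q) (θ : EConf A B Q S D h) : Prop :=
  (∃ d : D, θ.Δ = {(q0, TA.bot, d)}) ∧
  ∃ (c : A × B) (d' : D), θ.Γ = {(h c, d')}

/-- An accepting extended configuration: no remaining threads. -/
def Accepting (θ : EConf A B Q S D h) : Prop := θ.Δ = ∅

theorem relPow_snoc {α : Type} {R : α → α → Prop} :
    ∀ (n : ℕ) (a b c : α), relPow R n a b → R b c → relPow R (n + 1) a c
  | 0, a, b, c, hab, hbc => by
      have hab' : a = b := hab
      subst hab'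
      exact ⟨c, hbc, rfl⟩
  | n + 1, a, b, c, ⟨x, hax, hxb⟩, hbc => ⟨x, hax, relPow_snoc n x b c hxb hbc⟩

theorem mem_dataset_iff {A B Q S D : Type} {h : A × B → S} (θ : EConf A B Q S D h) (d : D) :
    d ∈ θ.dataset ↔ (θ.dfun d).Nonempty ∨ (θ.gfun d).Nonempty := Iff.rfl

theorem dataset_finite {A B Q S D : Type} {h : A × B → S} (θ : EConf A B Q S D h) :
    θ.dataset.Finite := by
  refine ((θ.finΔ.image (fun x => x.2.2)).union (θ.finΓ.image (fun x => x.2))).subset ?_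
  rintro d (⟨qa, hq⟩ | ⟨μ, hμ⟩)
  · exact Or.inl ⟨_, hq, rfl⟩
  · exact Or.inr ⟨_, hμ, rfl⟩

theorem profile_eq_of {A B Q S D : Type} {h : A × B → S} (θ₁ θ₂ : EConf A B Q S D h)
    (hr : θ₁.r = θ₂.r) (hm : θ₁.m = θ₂.m)
    (H : ∀ χ, {d | θ₁.gfun d = χ} = {d | θ₂.gfun d = χ} ∨
      (1 < {d | θ₁.gfun d = χ}.encard ∧ 1 < {d | θ₂.gfun d = χ}.encard)) :
    θ₁.profile = θ₂.profile := by
  unfold EConf.profile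
  rw [hr, hm]
  have key : ∀ (k : ℕ∞), k ≤ 1 →
      {χ | {d | θ₁.gfun d = χ}.encard = k} = {χ | {d | θ₂.gfun d = χ}.encard = k} := by
    intro k hk
    ext χ
    simp only [Set.mem_setOf_eq]
    rcases H χ with h1 | ⟨h1, h2⟩
    · rw [h1]
    · exact ⟨fun h3 => absurd h1 (by rw [h3]; exact not_lt.2 hk),
        fun h3 => absurd h2 (by rw [h3]; exact not_lt.2 hk)⟩
  rw [key 0 (by simp), key 1 le_rfl]

/-- Existence of the inc-successor with a prescribed fresh data value. -/
theorem exists_inc {A B Q S D : Type} [Fintype S] [Infinite D] {h : A × B → S}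
    (θ : EConf A B Q S D h) (d₀ e e₁ e₂ : D) (hne : e₁ ≠ e₂)
    (h1 : θ.gfun e₁ = θ.gfun d₀) (h2 : θ.gfun e₂ = θ.gfun d₀) (he : e ∉ θ.dataset) :
    ∃ θt : EConf A B Q S D h, inc θ θt ∧ θt.profile = θ.profile ∧
      (∀ d, d ≠ e → θt.dfun d = θ.dfun d ∧ θt.gfun d = θ.gfun d) ∧
      θt.dfun e ⊆ θ.dfun d₀ ∧ θt.gfun e = θ.gfun d₀ := by
  have hde : θ.dfun e = ∅ := by
    by_contra hc
    exact he (Or.inl (Set.nonempty_iff_ne_empty.2 hc))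
  have hge : θ.gfun e = ∅ := by
    by_contra hc
    exact he (Or.inr (Set.nonempty_iff_ne_empty.2 hc))
  have hnoc : ∀ μ ∈ θ.gfun d₀, ¬ ∃ c, μ = h c := by
    rintro μ hμ hc
    have m1 : (μ, e₁) ∈ θ.Γ := by rw [← h1] at hμ; exact hμ
    have m2 : (μ, e₂) ∈ θ.Γ := by rw [← h2] at hμ; exact hμ
    have := θ.uniq.unique ⟨m1, hc⟩ ⟨m2, hc⟩
    exact hne (congrArg Prod.snd this)
  let θt : EConf A B Q S D h :=
    { Δ := θ.Δ ∪ {x | x.2.2 = e ∧ (x.1, x.2.1, d₀) ∈ θ.Δ ∧ x.2.1 ≠ TA.topg}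
      Γ := θ.Γ ∪ {x | x.2 = e ∧ (x.1, d₀) ∈ θ.Γ}
      r := θ.r
      m := θ.m
      finΔ := by
        refine θ.finΔ.union ((θ.finΔ.image (fun x => (x.1, x.2.1, e))).subset ?_)
        rintro ⟨q, a, d⟩ ⟨rfl, hx, -⟩
        exact ⟨_, hx, rfl⟩
      finΓ := by
        refine θ.finΓ.union ((θ.finΓ.image (fun x => (x.1, e))).subset ?_)
        rintro ⟨q, d⟩ ⟨rfl, hx⟩
        exact ⟨_, hx, rfl⟩
      uniq := by
        obtain ⟨x, ⟨hx, hxc⟩, hu⟩ := θ.uniq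
        refine ⟨x, ⟨Or.inl hx, hxc⟩, ?_⟩
        rintro y ⟨hy | ⟨-, hy⟩, hyc⟩
        · exact hu y ⟨hy, hyc⟩
        · exact absurd hyc (hnoc _ hy) }
  have A1 : ∀ d, d ≠ e → θt.dfun d = θ.dfun d ∧ θt.gfun d = θ.gfun d := by
    intro d hd
    constructor
    · ext qa
      exact ⟨fun hx => hx.elim id (fun hx => absurd hx.1 hd), Or.inl⟩
    · ext μ
      exact ⟨fun hx => hx.elim id (fun hx => absurd hx.1 hd), Or.inl⟩
  have A2 : θt.dfun e = {qa ∈ θ.dfun d₀ | qa.2 ≠ TA.topg} := by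
    ext qa
    refine ⟨fun hx => hx.elim (fun hx => ?_) (fun hx => hx.2), fun hx => Or.inr ⟨rfl, hx⟩⟩
    have : qa ∈ θ.dfun e := hx
    rw [hde] at this
    exact this.elim
  have A3 : θt.gfun e = θ.gfun d₀ := by
    ext μ
    refine ⟨fun hx => hx.elim (fun hx => ?_) (fun hx => hx.2), fun hx => Or.inr ⟨rfl, hx⟩⟩
    have : μ ∈ θ.gfun e := hx
    rw [hge] at this
    exact this.elim
  refine ⟨θt, ⟨θ.dfun d₀, θ.gfun d₀, ⟨d₀, rfl, rfl⟩, ⟨e₁, e₂, hne, h1, h2⟩, e, he, rfl, rfl,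
    A1, A2, A3⟩, ?_, A1, ?_, A3⟩
  · refine profile_eq_of _ _ rfl rfl ?_
    intro χ
    by_cases hχ : θ.gfun d₀ = χ
    · right
      have hb : 1 < {d | θ.gfun d = χ}.encard :=
        Set.one_lt_encard_iff.2 ⟨e₁, e₂, h1.trans hχ, h2.trans hχ, hne⟩
      refine ⟨hb.trans_le (Set.encard_le_encard ?_), hb⟩
      intro d hd
      by_cases hd' : d = e
      · subst hd'
        exact A3.trans hχ
      · exact (A1 d hd').2.trans hd
    · by_cases hχ0 : χ = ∅
      · right
        obtain ⟨x, hx⟩ := ((dataset_finite θ).union (Set.finite_singleton e)).exists_notMem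
        obtain ⟨y, hy⟩ := (((dataset_finite θ).union
          (Set.finite_singleton e)).union (Set.finite_singleton x)).exists_notMem
        have hg : ∀ z, z ∉ θ.dataset ∪ {e} → θ.gfun z = χ ∧ θt.gfun z = χ := by
          intro z hz
          have hz1 : θ.gfun z = χ := by
            rw [hχ0]
            by_contra hc
            exact hz (Or.inl (Or.inr (Set.nonempty_iff_ne_empty.2 hc)))
          exact ⟨hz1, (A1 z (fun hc => hz (Or.inr hc))).2.trans hz1⟩
        have hxy : x ≠ y := fun hc => hy (Or.inr hc.symm)
        have hy' : y ∉ θ.dataset ∪ {e} := fun hc => hy (Or.inl hc)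
        exact ⟨Set.one_lt_encard_iff.2 ⟨x, y, (hg x hx).2, (hg y hy').2, hxy⟩,
          Set.one_lt_encard_iff.2 ⟨x, y, (hg x hx).1, (hg y hy').1, hxy⟩⟩
      · left
        ext d
        by_cases hd' : d = e
        · subst hd'
          simp only [Set.mem_setOf_eq, A3, hge]
          exact ⟨fun hc => absurd hc hχ, fun hc => absurd hc.symm hχ0⟩
        · simp only [Set.mem_setOf_eq, (A1 d hd').2]
  · rw [A2]
    exact fun x hx => hx.1

/-- **Injectivity lemma (Lemma 3.7)**: if `θ' ⪯ θ` and `Ds` is a finite set of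
data values, then some `θ̃` reachable from `θ'` by at most `|Ds|` inc-steps
satisfies `θ̃ ⪯_f θ` for some `f` injective on `Ds`. -/
theorem inc_injectivity (A B Q S D : Type) [Fintype A] [Fintype B] [Fintype Q]
    [Fintype S] [Semigroup S] [Infinite D] (h : A × B → S) (hNF1 : NF1 h)
    (θ θ' : EConf A B Q S D h) (hle : ple θ' θ)
    (Ds : Set D) (hDs : Ds.Finite) :
    ∃ (θt : EConf A B Q S D h) (f : D → D) (n : ℕ),
      n ≤ Ds.ncard ∧ relPow inc n θ' θt ∧ pleF f θt θ ∧ Set.InjOn f Ds := by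
  classical
  obtain ⟨f₀, hf₀⟩ := hle
  induction Ds, hDs using Set.Finite.induction_on with
  | empty => exact ⟨θ', f₀, 0, Nat.zero_le _, rfl, hf₀, Set.injOn_empty _⟩
  | @insert a Ds ha hfin ih =>
    obtain ⟨θ₁, f, n, hn, hpow, hple, hinj⟩ := ih
    have hcard := Set.ncard_insert_of_notMem ha hfin
    by_cases hfa : f a ∈ f '' Ds
    swap
    · exact ⟨θ₁, f, n, by omega, hpow, hple, (Set.injOn_insert ha).2 ⟨hinj, hfa⟩⟩
    obtain ⟨b, hb, hba⟩ := hfa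
    have hab : a ≠ b := fun hc => ha (hc ▸ hb)
    obtain ⟨hprof, hdata, hf⟩ := hple
    -- two data values with the same Γ-value as `f a`
    have htwo : 1 < {d | θ₁.gfun d = θ₁.gfun (f a)}.encard := by
      have h2 : 1 < {d | θ.gfun d = θ₁.gfun (f a)}.encard :=
        Set.one_lt_encard_iff.2 ⟨a, b, (hf a).2.symm, by
          rw [← hba]; exact (hf b).2.symm, hab⟩
      have p1 := congrArg Prod.fst hprof
      have p2 := congrArg (fun x => x.2.1) hprof
      simp only [EConf.profile] at p1 p2
      have q1 := Set.ext_iff.1 p1 (θ₁.gfun (f a))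
      have q2 := Set.ext_iff.1 p2 (θ₁.gfun (f a))
      simp only [Set.mem_setOf_eq] at q1 q2
      by_contra hc
      rcases (not_lt.1 hc).lt_or_eq with h3 | h3
      · have := q1.1 (ENat.lt_one_iff_eq_zero.1 h3)
        rw [this] at h2
        simp at h2
      · have := q2.1 h3
        rw [this] at h2
        simp at h2
    obtain ⟨e₁, e₂, h1, h2, hne⟩ := Set.one_lt_encard_iff.1 htwo
    obtain ⟨e, he⟩ := ((dataset_finite θ₁).union (hfin.image f)).exists_notMem
    have he1 : e ∉ θ₁.dataset := fun hc => he (Or.inl hc)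
    have he2 : e ∉ f '' Ds := fun hc => he (Or.inr hc)
    obtain ⟨e', he'⟩ := ((dataset_finite θ₁).union (Set.finite_singleton e)).exists_notMem
    have he'1 : e' ∉ θ₁.dataset := fun hc => he' (Or.inl hc)
    have he'2 : e' ≠ e := fun hc => he' (Or.inr hc)
    obtain ⟨θt, hinc, hpt, A1, A2, A3⟩ := exists_inc θ₁ (f a) e e₁ e₂ hne h1 h2 he1
    have hempty : ∀ z, z ∉ θ₁.dataset → θ₁.dfun z = ∅ ∧ θ₁.gfun z = ∅ := by
      intro z hz
      constructor
      · by_contra hc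
        exact hz (Or.inl (Set.nonempty_iff_ne_empty.2 hc))
      · by_contra hc
        exact hz (Or.inr (Set.nonempty_iff_ne_empty.2 hc))
    let f' : D → D := fun d => if d = a then e else if f d = e then e' else f d
    have fa : f' a = e := if_pos rfl
    have fe : ∀ d, d ≠ a → f d = e → f' d = e' := fun d h1 h2 => by simp [f', h1, h2]
    have fn : ∀ d, d ≠ a → f d ≠ e → f' d = f d := fun d h1 h2 => by simp [f', h1, h2]
    have fD : ∀ d ∈ Ds, f' d = f d := fun d hd =>
      fn d (fun hc => ha (hc ▸ hd)) (fun hc => he2 ⟨d, hd, hc⟩)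
    refine ⟨θt, f', n + 1, by omega, relPow_snoc _ _ _ _ hpow hinc,
      ⟨hpt.trans hprof, ?_, ?_⟩, ?_⟩
    · intro d hd
      by_cases hde : d = e
      · exact ⟨a, fa.trans hde.symm⟩
      · have hd1 : d ∈ θ₁.dataset := by
          rw [mem_dataset_iff] at hd ⊢
          rwa [(A1 d hde).1, (A1 d hde).2] at hd
        obtain ⟨x, rfl⟩ := hdata hd1
        by_cases hxa : x = a
        · subst hxa
          exact ⟨b, (fD b hb).trans hba⟩
        · exact ⟨x, fn x hxa hde⟩
    · intro d
      by_cases hda : d = a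
      · subst hda
        rw [fa]
        exact ⟨A2.trans (hf d).1, A3.trans (hf d).2⟩
      · by_cases hde : f d = e
        · rw [fe d hda hde, (A1 e' he'2).1, (A1 e' he'2).2, (hempty e' he'1).1,
            (hempty e' he'1).2]
          refine ⟨Set.empty_subset _, ?_⟩
          rw [← (hf d).2, hde, (hempty e he1).2]
        · rw [fn d hda hde, (A1 _ hde).1, (A1 _ hde).2]
          exact hf d
    · refine (Set.injOn_insert ha).2 ⟨?_, ?_⟩
      · intro x hx y hy hxy
        rw [fD x hx, fD y hy] at hxy
        exact hinj hx hy hxy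
      · rintro ⟨x, hx, hxe⟩
        rw [fa, fD x hx] at hxe
        exact he2 ⟨x, hx, hxe⟩

end ECBUDA
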